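/- For every integer l, the conjugate M_i · N_{(1+i,1)}^l · M_i⁻¹ equals the matrix N_{(l(−1+i), l²)}. -/

import Mathlib

open Matrix Complex

/-- The matrix `C` of the quadratic form defining the Siegel domain. -/
noncomputable def Cmat : Matrix (Fin 3) (Fin 3) ℂ := !![0,0,-1; 0,1,0; -1,0,0]

/-- Membership in `SU(2,1)`: `Gᴴ C G = C` and `det G = 1`. -/
def inSU21 (G : Matrix (Fin 3) (Fin 3) ℂ) : Prop :=
  G.conjTranspose * Cmat * G = Cmat ∧ G.det = 1

/-- A complex number is a Gaussian integer. -/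
def IsGaussianInt (z : ℂ) : Prop := ∃ m n : ℤ, z = (m : ℂ) + (n : ℂ) * Complex.I

/-- The Heisenberg translation matrix `N_a` for `a = (a₁, a₂) ∈ ℂ²`. -/
noncomputable def N (a : ℂ × ℂ) : Matrix (Fin 3) (Fin 3) ℂ :=
  !![1, 0, 0; a.1, 1, 0; a.2, star a.1, 1]

/-- The rotation matrix `M_i = diag(i, -1, i)`. -/
noncomputable def Mi : Matrix (Fin 3) (Fin 3) ℂ :=
  !![Complex.I, 0, 0; 0, -1, 0; 0, 0, Complex.I]

/-- The involution `J`. -/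
noncomputable def Jmat : Matrix (Fin 3) (Fin 3) ℂ := !![0, 0, -1; 0, -1, 0; -1, 0, 0]

/-- `N_{(0,i)}` as an element of `SL(3,ℂ)`. -/
noncomputable def N0i : Matrix.SpecialLinearGroup (Fin 3) ℂ :=
  ⟨N (0, Complex.I), by simp [N, Matrix.det_fin_three]⟩

/-- `N_{(1+i,1)}` as an element of `SL(3,ℂ)`. -/
noncomputable def N1 : Matrix.SpecialLinearGroup (Fin 3) ℂ :=
  ⟨N (1 + Complex.I, 1), by simp [N, Matrix.det_fin_three]⟩

/-- `M_i` as an element of `SL(3,ℂ)`. -/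
noncomputable def MiSL : Matrix.SpecialLinearGroup (Fin 3) ℂ :=
  ⟨Mi, by simp [Mi, Matrix.det_fin_three]⟩

/-- `J` as an element of `SL(3,ℂ)`. -/
noncomputable def JSL : Matrix.SpecialLinearGroup (Fin 3) ℂ :=
  ⟨Jmat, by simp [Jmat, Matrix.det_fin_three]⟩

/-- `N_{(0,i)}` as an invertible matrix. -/
noncomputable def N0iGL : GL (Fin 3) ℂ := N0i.toGL
/-- `N_{(1+i,1)}` as an invertible matrix. -/
noncomputable def N1GL : GL (Fin 3) ℂ := N1.toGL
/-- `M_i` as an invertible matrix. -/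
noncomputable def MiGL : GL (Fin 3) ℂ := MiSL.toGL
/-- `J` as an invertible matrix. -/
noncomputable def JGL : GL (Fin 3) ℂ := JSL.toGL

lemma N_mul_N (a b : ℂ × ℂ) :
    N a * N b = N (a.1 + b.1, a.2 + star a.1 * b.1 + b.2) := by
  ext i j
  fin_cases i <;> fin_cases j <;> simp [N, Matrix.mul_apply, Fin.sum_univ_three]

lemma coe_N1GL : (N1GL : Matrix (Fin 3) (Fin 3) ℂ) = N (1 + Complex.I, 1) := rfl

lemma coe_MiGL : (MiGL : Matrix (Fin 3) (Fin 3) ℂ) = Mi := rfl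

lemma N_mul_N1GL (l : ℤ) :
    N ((l : ℂ) * (1 + Complex.I), (l : ℂ) ^ 2) * (N1GL : Matrix (Fin 3) (Fin 3) ℂ)
      = N (((l + 1 : ℤ) : ℂ) * (1 + Complex.I), ((l + 1 : ℤ) : ℂ) ^ 2) := by
  rw [coe_N1GL, N_mul_N]
  congr 2
  · push_cast
    ring
  · simp only [star_mul', star_add, star_one, Complex.star_def, Complex.conj_I, map_intCast]
    push_cast
    linear_combination (-(l : ℂ)) * Complex.I_sq

lemma coe_N1GL_zpow (l : ℤ) :
    ((N1GL ^ l : GL (Fin 3) ℂ) : Matrix (Fin 3) (Fin 3) ℂ)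
      = N ((l : ℂ) * (1 + Complex.I), (l : ℂ) ^ 2) := by
  induction l using Int.induction_on with
  | zero =>
    ext i j
    fin_cases i <;> fin_cases j <;> simp [N]
  | succ k ih => rw [_root_.zpow_add_one, Units.val_mul, ih, N_mul_N1GL]
  | pred k ih =>
    apply N1GL.isUnit.mul_right_cancel
    rw [N_mul_N1GL, ← Units.val_mul, ← _root_.zpow_add_one, sub_add_cancel, ih]

lemma Mi_mul_N (x y : ℂ) : Mi * N (x, y) = N (Complex.I * x, y) * Mi := by
  ext i j
  fin_cases i <;> fin_cases j <;> simp [N, Mi, Matrix.mul_apply, Fin.sum_univ_three]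
  · linear_combination (-x) * Complex.I_sq
  · ring

/-- Conjugating powers of `N_{(1+i,1)}` by `M_i`. -/
theorem Mi_conj_N_zpow (l : ℤ) :
    ((MiGL * N1GL ^ l * MiGL⁻¹ : GL (Fin 3) ℂ) : Matrix (Fin 3) (Fin 3) ℂ)
      = N ((l : ℂ) * (-1 + Complex.I), (l : ℂ) ^ 2) := by
  rw [Units.val_mul, Units.val_mul, Units.mul_inv_eq_iff_eq_mul, coe_MiGL, coe_N1GL_zpow,
    Mi_mul_N]
  congr 3
  linear_combination (l : ℂ) * Complex.I_sq
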